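/- Let H be a subgroup of G whose index [G:H] is prime to p and which controls the fusion of p-elements of G (i.e. any two p-elements of H that are conjugate in G are already conjugate in H). Then restriction of class functions induces an isomorphism of 𝒪_𝔭-algebras R_𝔭(G,1) ≅ R_𝔭(H,1); in particular ℓ_p(G,1) = ℓ_p(H,1) and ext_p^1(G,1) = ext_p^1(H,1). -/

import Mathlib

open scoped TensorProduct Classical

/-! Common definitions: the character ring of a finite group, following Bonnafé,
"On the character ring of a finite group". -/

/-- The set of characters of finite-dimensional `K`-linear representations of `G`. -/
def charSet (K G : Type u) [Field K] [Group G] : Set (G → K) :=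
  {f | ∃ V : FDRep K G, f = FDRep.character V}

/-- The character ring `R(G)` of virtual characters, i.e. the subring of the `K`-algebra of
functions `G → K` generated by the characters.  Over a splitting field of characteristic zero
this is exactly the set of `ℤ`-linear combinations of irreducible characters. -/
def charRing (K G : Type u) [Field K] [Group G] : Subring (G → K) :=
  Subring.closure (charSet K G)

/-- `g` is `p`-regular if its order is prime to `p`. -/
def IsPRegular (p : ℕ) {G : Type*} [Monoid G] (g : G) : Prop :=
  Nat.Coprime (orderOf g) p

/-- `g` is a `p`-element if its order is a power of `p`. -/
def IsPElement (p : ℕ) {G : Type*} [Monoid G] (g : G) : Prop :=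
  ∃ n : ℕ, orderOf g = p ^ n

/-- The `p'`-part `g_{p'}` of an element `g` of a finite group:  writing `orderOf g = q * m'`
with `q` the `p`-part of the order, this is `g ^ (q * u)` where `u` is the inverse of
`q` modulo `m'`; it is the unique `p`-regular power of `g` such that `g * g_{p'}⁻¹` is a
`p`-element commuting with it. -/
noncomputable def pPrimePart (p : ℕ) {G : Type*} [Group G] (g : G) : G :=
  g ^ (p ^ (orderOf g).factorization p *
      (((p : ZMod (orderOf g / p ^ (orderOf g).factorization p)) ^
        (orderOf g).factorization p)⁻¹).val)

/-- The `p'`-section `S_{p'}(C)` of the conjugacy class `C` of `g` : the set of all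
`x ∈ G` whose `p'`-part lies in the class of `g`. -/
def pSection (p : ℕ) {G : Type*} [Group G] (g : G) : Set G :=
  {x | IsConj g (pPrimePart p x)}

/-- The idempotent class function `e_C` attached to the class `C` of `g`:  the characteristic
function (with values in `K`) of the `p'`-section of `C`. -/
noncomputable def eFun (p : ℕ) (K : Type*) [Field K] {G : Type*} [Group G] (g : G) : G → K :=
  fun x => if IsConj g (pPrimePart p x) then 1 else 0

/-- The number of conjugacy classes of `G` contained in a subset `S`. -/
noncomputable def numClassesIn {G : Type*} [Group G] (S : Set G) : ℕ :=
  Nat.card {c : ConjClasses G // c.carrier ⊆ S}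

/-- The image of the localization `𝒪_𝔭` in the fraction field `K`: fractions `a / b` with
`b ∉ 𝔭`. -/
def locSet (𝒪 K : Type*) [CommRing 𝒪] [Field K] [Algebra 𝒪 K] (𝔭 : Ideal 𝒪) : Set K :=
  {x | ∃ a b : 𝒪, b ∉ 𝔭 ∧ x * algebraMap 𝒪 K b = algebraMap 𝒪 K a}

/-- `𝒪_𝔭 R(G)`: the `𝒪_𝔭`-span of the character ring inside class functions `G → K`,
realized as the subring generated by `𝒪_𝔭`-constants and characters. -/
def locCharRing (𝒪 : Type*) (K : Type u) [CommRing 𝒪] [Field K] [Algebra 𝒪 K] (𝔭 : Ideal 𝒪)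
    (G : Type u) [Group G] : Subring (G → K) :=
  Subring.closure ({f | ∃ x ∈ locSet 𝒪 K 𝔭, f = Function.const G x} ∪ charSet K G)

/-- The ideal `𝔭 · 𝒪_𝔭R(G)` of `𝒪_𝔭R(G)`, generated by the constants from `𝔭`. -/
def pConstIdeal (𝒪 : Type*) (K : Type u) [CommRing 𝒪] [Field K] [Algebra 𝒪 K] (𝔭 : Ideal 𝒪)
    (G : Type u) [Group G] : Ideal (locCharRing 𝒪 K 𝔭 G) :=
  Ideal.span {f | ∃ a ∈ 𝔭, (f : G → K) = Function.const G (algebraMap 𝒪 K a)}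

/-- `kR(G) = k ⊗_ℤ R(G)`, realized through the canonical identification
`k ⊗_ℤ R(G) ≅ 𝒪_𝔭R(G) ⧸ 𝔭·𝒪_𝔭R(G)` (where `k = 𝒪/𝔭`). -/
abbrev kCharRing (𝒪 : Type*) (K : Type u) [CommRing 𝒪] [Field K] [Algebra 𝒪 K] (𝔭 : Ideal 𝒪)
    (G : Type u) [Group G] :=
  locCharRing 𝒪 K 𝔭 G ⧸ pConstIdeal 𝒪 K 𝔭 G

/-- The ideal of `𝒪_𝔭R(G)` cutting out the block `R_𝔭(G, C)` with identity element the
idempotent `e : 𝒪_𝔭R(G)`, reduced mod `𝔭`:  the block `kR(G)·ē` is canonically the quotient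
by `𝔭·𝒪_𝔭R(G) + (1 - e)·𝒪_𝔭R(G)`. -/
def blockIdeal (𝒪 : Type*) (K : Type u) [CommRing 𝒪] [Field K] [Algebra 𝒪 K] (𝔭 : Ideal 𝒪)
    (G : Type u) [Group G] (e : locCharRing 𝒪 K 𝔭 G) : Ideal (locCharRing 𝒪 K 𝔭 G) :=
  pConstIdeal 𝒪 K 𝔭 G ⊔ Ideal.span {1 - e}

/-- The block `kR_𝔭(G, C) = kR(G)·ē_C` of `kR(G)`, as a (unital) `k`-algebra, realized as the
quotient of `𝒪_𝔭R(G)` by `𝔭·𝒪_𝔭R(G) + (1 - e_C)·𝒪_𝔭R(G)`. -/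
abbrev blockAlg (𝒪 : Type*) (K : Type u) [CommRing 𝒪] [Field K] [Algebra 𝒪 K] (𝔭 : Ideal 𝒪)
    (G : Type u) [Group G] (e : locCharRing 𝒪 K 𝔭 G) :=
  locCharRing 𝒪 K 𝔭 G ⧸ blockIdeal 𝒪 K 𝔭 G e

/-- The constants, as a ring morphism `𝒪 →+* 𝒪_𝔭R(G)`. -/
noncomputable def constRingHom (𝒪 : Type*) (K : Type u) [CommRing 𝒪] [Field K] [Algebra 𝒪 K]
    (𝔭 : Ideal 𝒪) [𝔭.IsMaximal] (G : Type u) [Group G] : 𝒪 →+* locCharRing 𝒪 K 𝔭 G where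
  toFun a := ⟨Function.const G (algebraMap 𝒪 K a),
    Subring.subset_closure (Or.inl ⟨algebraMap 𝒪 K a,
      ⟨a, 1, fun h => (Ideal.ne_top_iff_one 𝔭).mp (Ideal.IsMaximal.ne_top ‹_›) h, by simp⟩, rfl⟩)⟩
  map_one' := Subtype.ext (funext fun g => by simp)
  map_mul' a b := Subtype.ext (funext fun g => by simp)
  map_zero' := Subtype.ext (funext fun g => by simp)
  map_add' a b := Subtype.ext (funext fun g => by simp)

/-- The structural morphism giving quotients of `𝒪_𝔭R(G)` by ideals containing
`𝔭·𝒪_𝔭R(G)` (such as `kR(G)` and its blocks) their `k = 𝒪/𝔭`-algebra structure. -/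
noncomputable def kScalars (𝒪 : Type*) (K : Type u) [CommRing 𝒪] [Field K] [Algebra 𝒪 K]
    (𝔭 : Ideal 𝒪) [𝔭.IsMaximal] (G : Type u) [Group G]
    (I : Ideal (locCharRing 𝒪 K 𝔭 G)) (hI : pConstIdeal 𝒪 K 𝔭 G ≤ I) :
    (𝒪 ⧸ 𝔭) →+* (locCharRing 𝒪 K 𝔭 G ⧸ I) :=
  Ideal.Quotient.lift 𝔭 ((Ideal.Quotient.mk I).comp (constRingHom 𝒪 K 𝔭 G))
    (fun a ha => by
      simp only [RingHom.comp_apply]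
      exact Ideal.Quotient.eq_zero_iff_mem.mpr (hI (Ideal.subset_span ⟨a, ha, rfl⟩)))

/-- The `k`-algebra structure morphism of the block `kR_𝔭(G, C)`. -/
noncomputable def blockScalars (𝒪 : Type*) (K : Type u) [CommRing 𝒪] [Field K] [Algebra 𝒪 K]
    (𝔭 : Ideal 𝒪) [𝔭.IsMaximal] (G : Type u) [Group G] (e : locCharRing 𝒪 K 𝔭 G) :
    (𝒪 ⧸ 𝔭) →+* blockAlg 𝒪 K 𝔭 G e :=
  kScalars 𝒪 K 𝔭 G (blockIdeal 𝒪 K 𝔭 G e) le_sup_left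

/-- The Jacobson radical of a ring. -/
noncomputable def jacRad (A : Type*) [CommRing A] : Ideal A := (⊥ : Ideal A).jacobson

/-- The Loewy length of `A`: the least `n` with `(Rad A) ^ n = 0`. -/
noncomputable def loewyLength (A : Type*) [CommRing A] : ℕ :=
  sInf {n : ℕ | jacRad A ^ n = ⊥}

/-- `Rad A / (Rad A)²`. -/
noncomputable abbrev radQuotient (A : Type*) [CommRing A] :=
  jacRad A ⧸ (Submodule.comap (jacRad A).subtype (jacRad A ^ 2 : Ideal A))

/-- `dim_k Rad(A)/Rad(A)²`, the `k`-vector space structure being induced by a ring morphism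
`k →+* A`. -/
noncomputable def extDim (k : Type*) [CommRing k] {A : Type*} [CommRing A] (φ : k →+* A) : ℕ :=
  letI : Module k (radQuotient A) := Module.compHom _ φ
  Module.finrank k (radQuotient A)

/-- `dim_k A`, the `k`-vector space structure being induced by a ring morphism `k →+* A`. -/
noncomputable def kDim (k : Type*) [CommRing k] {A : Type*} [CommRing A] (φ : k →+* A) : ℕ :=
  letI : Module k A := Module.compHom _ φ
  Module.finrank k A

/-- `dim_k I` for an ideal `I` of `A`, the `k`-vector space structure being induced by a ring
morphism `k →+* A`. -/
noncomputable def idealKDim (k : Type*) [CommRing k] {A : Type*} [CommRing A] (φ : k →+* A)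
    (I : Ideal A) : ℕ :=
  letI : Module k I := Module.compHom _ φ
  Module.finrank k I

section AuxiliaryLemmas

section Ring

/-- A ring isomorphism carries the Jacobson radical onto the Jacobson radical. -/
lemma map_jacRad {A B : Type*} [CommRing A] [CommRing B] (e : A ≃+* B) :
    (jacRad A).map e.toRingHom = jacRad B := by
  unfold jacRad
  rw [Ideal.map_jacobson_of_bijective (f := e.toRingHom) e.bijective, Ideal.map_bot]

lemma map_jacRad_pow {A B : Type*} [CommRing A] [CommRing B] (e : A ≃+* B) (n : ℕ) :
    (jacRad A ^ n).map e.toRingHom = jacRad B ^ n := by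
  rw [Ideal.map_pow, map_jacRad]

lemma mem_jacRad_pow_iff {A B : Type*} [CommRing A] [CommRing B] (e : A ≃+* B) (n : ℕ) (x : A) :
    e x ∈ jacRad B ^ n ↔ x ∈ jacRad A ^ n := by
  rw [← map_jacRad_pow e]
  constructor
  · intro h
    obtain ⟨y, hy, hxy⟩ := (Ideal.mem_map_iff_of_surjective e.toRingHom e.surjective).1 h
    rwa [← e.injective hxy]
  · exact fun h => Ideal.mem_map_of_mem e.toRingHom h

lemma mem_jacRad_iff {A B : Type*} [CommRing A] [CommRing B] (e : A ≃+* B) (x : A) :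
    e x ∈ jacRad B ↔ x ∈ jacRad A := by
  simpa using mem_jacRad_pow_iff e 1 x

lemma loewyLength_congr {A B : Type*} [CommRing A] [CommRing B] (e : A ≃+* B) :
    loewyLength A = loewyLength B := by
  unfold loewyLength
  congr 1
  ext n
  rw [Set.mem_ofPred_eq, Set.mem_ofPred_eq, ← map_jacRad_pow e]
  exact (Ideal.map_eq_bot_iff_of_injective (f := e.toRingHom) e.injective).symm

lemma extDim_congr {k A B : Type*} [CommRing k] [CommRing A] [CommRing B] (e : A ≃+* B)
    (φ : k →+* A) (ψ : k →+* B) (h : ∀ x, e (φ x) = ψ x) : extDim k φ = extDim k ψ := by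
  unfold extDim
  let f : jacRad A →ₛₗ[e.toRingHom] jacRad B :=
    { toFun := fun x => ⟨e x, (mem_jacRad_iff e x).2 x.2⟩
      map_add' := fun x y => Subtype.ext (by simp)
      map_smul' := fun a x => Subtype.ext (by simp) }
  let F := Submodule.mapQ (Submodule.comap (jacRad A).subtype (jacRad A ^ 2 : Ideal A))
    (Submodule.comap (jacRad B).subtype (jacRad B ^ 2 : Ideal B)) f
      (fun x hx => by
        rw [Submodule.mem_comap, Submodule.mem_comap]
        exact (mem_jacRad_pow_iff e 2 (x : A)).2 (Submodule.mem_comap.1 hx))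
  have hF : Function.Bijective F := by
    constructor
    · rw [injective_iff_map_eq_zero]
      intro x
      obtain ⟨x, rfl⟩ := Submodule.Quotient.mk_surjective _ x
      intro hx
      rw [Submodule.mapQ_apply, Submodule.Quotient.mk_eq_zero] at hx
      rw [Submodule.Quotient.mk_eq_zero]
      exact (mem_jacRad_pow_iff e 2 x).1 hx
    · intro y
      obtain ⟨y, rfl⟩ := Submodule.Quotient.mk_surjective _ y
      refine ⟨Submodule.Quotient.mk
        ⟨e.symm y, (mem_jacRad_iff e _).1 (by simp)⟩, ?_⟩
      rw [Submodule.mapQ_apply]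
      congr 1
      exact Subtype.ext (e.apply_symm_apply _)
  let : Module k (radQuotient A) := Module.compHom _ φ
  let : Module k (radQuotient B) := Module.compHom _ ψ
  let F' : radQuotient A →ₗ[k] radQuotient B :=
    { toFun := F
      map_add' := map_add F
      map_smul' := fun c x => by
        change F (φ c • x) = ψ c • F x
        rw [map_smulₛₗ, ← h]
        rfl }
  exact (LinearEquiv.ofBijective F' hF).finrank_eq

end Ring

section PElement

lemma pPrimePart_eq_one_iff (p : ℕ) [hp : Fact p.Prime] {G : Type*} [Group G] [Finite G] (g : G) :
    pPrimePart p g = 1 ↔ IsPElement p g := by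
  set n := orderOf g with hn
  have hn0 : n ≠ 0 := (orderOf_pos g).ne'
  set q := p ^ n.factorization p with hq
  set m := n / q with hm
  have hqm : q * m = n := Nat.ordProj_mul_ordCompl_eq_self n p
  have hq0 : 0 < q := pow_pos hp.out.pos _
  have hcop : Nat.Coprime (p ^ n.factorization p) m :=
    Nat.Coprime.pow_left _ (Nat.coprime_ordCompl hp.out hn0)
  have key : pPrimePart p g = 1 ↔ m = 1 := by
    unfold pPrimePart
    rw [← orderOf_dvd_iff_pow_eq_one, ← hn, ← hq, ← hm]
    nth_rewrite 1 [← hqm]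
    rw [Nat.mul_dvd_mul_iff_left hq0]
    constructor
    · intro h
      have hm0 : m ≠ 0 := by rintro h0; rw [h0, mul_zero] at hqm; exact hn0 hqm.symm
      have : NeZero m := ⟨hm0⟩
      have h0 := (ZMod.natCast_eq_zero_iff _ m).2 h
      rw [ZMod.natCast_val, ZMod.cast_id', id] at h0
      have h1 := ZMod.coe_mul_inv_eq_one (p ^ n.factorization p) hcop
      rw [Nat.cast_pow, h0, mul_zero] at h1
      have h2 : ((1 : ℕ) : ZMod m) = 0 := by rw [Nat.cast_one, ← h1]
      exact Nat.dvd_one.1 ((ZMod.natCast_eq_zero_iff 1 m).1 h2)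
    · intro h
      rw [h]
      exact one_dvd _
  rw [key]
  constructor
  · intro h
    rw [h, mul_one] at hqm
    exact ⟨_, hqm.symm⟩
  · rintro ⟨j, hj⟩
    rw [← hn] at hj
    rw [hm, hq, hj, hp.out.factorization_pow, Finsupp.single_eq_same]
    exact Nat.div_self (pow_pos hp.out.pos _)

lemma eFun_one_apply (p : ℕ) [Fact p.Prime] (K : Type*) [Field K] {G : Type*} [Group G] [Finite G]
    (g : G) : eFun p K (1 : G) g = if IsPElement p g then 1 else 0 := by
  unfold eFun
  simp only [isConj_one_right, pPrimePart_eq_one_iff]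

lemma IsPElement.coe_iff {p : ℕ} {G : Type*} [Group G] {H : Subgroup G} (h : H) :
    IsPElement p (h : G) ↔ IsPElement p h := by
  simp [IsPElement]

lemma IsPElement.of_isConj {p : ℕ} {G : Type*} [Group G] {x y : G} (hxy : IsConj x y)
    (hx : IsPElement p x) : IsPElement p y := by
  obtain ⟨c, rfl⟩ := isConj_iff.1 hxy
  obtain ⟨n, hn⟩ := hx
  refine ⟨n, ?_⟩
  rw [← hn, ← MulAut.conj_apply]
  exact MulEquiv.orderOf_eq (MulAut.conj c) x

/-- The number of fixed points of a `p`-element on `G ⧸ H` is prime to `p` if `[G : H]` is. -/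
lemma IsPElement.coprime_card_fixed {p : ℕ} [hp : Fact p.Prime] {G : Type*} [Group G] [Finite G]
    {H : Subgroup G} (hind : Nat.Coprime H.index p) {g : G} (hg : IsPElement p g) :
    Nat.Coprime (Nat.card {c : G ⧸ H // g • c = c}) p := by
  have hP : IsPGroup p (Subgroup.zpowers g) := by
    obtain ⟨n, hn⟩ := hg
    exact IsPGroup.of_card (n := n) (by rw [Nat.card_zpowers, hn])
  have h := hP.card_modEq_card_fixedPoints (G ⧸ H)
  have hfix : Nat.card (MulAction.fixedPoints (Subgroup.zpowers g) (G ⧸ H)) =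
      Nat.card {c : G ⧸ H // g • c = c} := by
    refine Nat.card_congr (Equiv.subtypeEquivRight fun c => ⟨fun h => ?_, fun h => ?_⟩)
    · exact h ⟨g, Subgroup.mem_zpowers g⟩
    · have hle : Subgroup.zpowers g ≤ MulAction.stabilizer G c := by
        rw [Subgroup.zpowers_le]
        exact h
      exact fun x => hle x.2
  rw [hfix] at h
  have h' := h.gcd_eq
  rw [Nat.Coprime, ← h']
  exact hind

end PElement

section CharRing

lemma charSet_mul_mem {K G : Type u} [Field K] [Group G] {χ ψ : G → K}
    (hχ : χ ∈ charSet K G) (hψ : ψ ∈ charSet K G) : χ * ψ ∈ charSet K G := by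
  obtain ⟨V, rfl⟩ := hχ
  obtain ⟨W, rfl⟩ := hψ
  exact ⟨CategoryTheory.MonoidalCategoryStruct.tensorObj V W, (FDRep.char_tensor V W).symm⟩

lemma one_mem_charSet {K G : Type u} [Field K] [Group G] : (1 : G → K) ∈ charSet K G :=
  ⟨FDRep.of (1 : G →* (K →ₗ[K] K)), funext fun g => by
    simp [FDRep.character]⟩

lemma comp_subtype_mem_charSet {K G : Type u} [Field K] [Group G] (H : Subgroup G) {χ : G → K}
    (hχ : χ ∈ charSet K G) : χ ∘ ((↑) : H → G) ∈ charSet K H := by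
  obtain ⟨V, rfl⟩ := hχ
  exact ⟨FDRep.of (V.ρ.comp H.subtype), rfl⟩

lemma apply_eq_of_isConj_of_mem_charSet {K G : Type u} [Field K] [Group G] {χ : G → K}
    (hχ : χ ∈ charSet K G) {x y : G} (hxy : IsConj x y) : χ x = χ y := by
  obtain ⟨V, rfl⟩ := hχ
  obtain ⟨c, rfl⟩ := isConj_iff.1 hxy
  exact (FDRep.char_conj V x c).symm

variable {𝒪 : Type*} {K : Type u} [CommRing 𝒪] [Field K] [Algebra 𝒪 K] {𝔭 : Ideal 𝒪}

lemma apply_eq_of_isConj_of_mem_locCharRing {G : Type u} [Group G] {f : G → K}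
    (hf : f ∈ locCharRing 𝒪 K 𝔭 G) {x y : G} (hxy : IsConj x y) : f x = f y := by
  induction hf using Subring.closure_induction with
  | mem f hf =>
    rcases hf with ⟨a, -, rfl⟩ | hf
    · rfl
    · exact apply_eq_of_isConj_of_mem_charSet hf hxy
  | zero => rfl
  | one => rfl
  | add f g _ _ h₁ h₂ => simp only [Pi.add_apply, h₁, h₂]
  | neg f _ h => simp only [Pi.neg_apply, h]
  | mul f g _ _ h₁ h₂ => simp only [Pi.mul_apply, h₁, h₂]

lemma const_mem_locCharRing {G : Type u} [Group G] {a : K} (ha : a ∈ locSet 𝒪 K 𝔭) :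
    Function.const G a ∈ locCharRing 𝒪 K 𝔭 G :=
  Subring.subset_closure (Or.inl ⟨a, ha, rfl⟩)

lemma comp_subtype_mem_locCharRing {G : Type u} [Group G] (H : Subgroup G) {f : G → K}
    (hf : f ∈ locCharRing 𝒪 K 𝔭 G) : f ∘ ((↑) : H → G) ∈ locCharRing 𝒪 K 𝔭 H := by
  induction hf using Subring.closure_induction with
  | mem f hf =>
    rcases hf with ⟨a, ha, rfl⟩ | hf
    · exact const_mem_locCharRing ha
    · exact Subring.subset_closure (Or.inr (comp_subtype_mem_charSet H hf))
  | zero => exact zero_mem _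
  | one => exact one_mem _
  | add f g _ _ h₁ h₂ => exact add_mem h₁ h₂
  | neg f _ h => exact neg_mem h
  | mul f g _ _ h₁ h₂ => exact mul_mem h₁ h₂

/-- Every element of `𝒪_𝔭R(G)` is a sum of `𝒪_𝔭`-multiples of characters. -/
lemma locCharRing_le_closure [h𝔭 : 𝔭.IsPrime] {G : Type u} [Group G] {f : G → K}
    (hf : f ∈ locCharRing 𝒪 K 𝔭 G) :
    f ∈ AddSubgroup.closure {f | ∃ a ∈ locSet 𝒪 K 𝔭, ∃ χ ∈ charSet K G, f = a • χ} := by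
  have h1 : (1 : K) ∈ locSet 𝒪 K 𝔭 :=
    ⟨1, 1, fun h => h𝔭.ne_top ((Ideal.eq_top_iff_one 𝔭).2 h), by simp⟩
  let M : Submonoid (G → K) :=
    { carrier := {f | ∃ a ∈ locSet 𝒪 K 𝔭, ∃ χ ∈ charSet K G, f = a • χ}
      one_mem' := ⟨1, h1, 1, one_mem_charSet, by simp⟩
      mul_mem' := by
        rintro _ _ ⟨a, ⟨a₁, a₂, ha₂, ha⟩, χ, hχ, rfl⟩ ⟨b, ⟨b₁, b₂, hb₂, hb⟩, ψ, hψ, rfl⟩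
        refine ⟨a * b, ⟨a₁ * b₁, a₂ * b₂, fun h => (h𝔭.mem_or_mem h).elim ha₂ hb₂, ?_⟩,
          χ * ψ, charSet_mul_mem hχ hψ, smul_mul_smul_comm a χ b ψ⟩
        rw [map_mul, map_mul, ← ha, ← hb]
        ring }
  have hM : Submonoid.closure ({f | ∃ x ∈ locSet 𝒪 K 𝔭, f = Function.const G x} ∪ charSet K G)
      ≤ M := by
    rw [Submonoid.closure_le]
    rintro f (⟨a, ha, rfl⟩ | hf)
    · exact ⟨a, ha, 1, one_mem_charSet, by ext; simp⟩
    · exact ⟨1, h1, f, hf, by simp⟩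
  exact AddSubgroup.closure_mono hM (Subring.mem_closure_iff.1 hf)

end CharRing

section Induction

lemma LinearMap.trace_pi {K V ι : Type*} [Field K] [AddCommGroup V] [Module K V]
    [Module.Finite K V] [Fintype ι] (T : (ι → V) →ₗ[K] (ι → V)) :
    LinearMap.trace K (ι → V) T = ∑ i, LinearMap.trace K V
      (LinearMap.proj i ∘ₗ T ∘ₗ LinearMap.single K (fun _ => V) i) := by
  have hT : T = ∑ i, (T ∘ₗ LinearMap.single K (fun _ => V) i) ∘ₗ LinearMap.proj i := by
    refine LinearMap.ext fun φ => ?_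
    simp only [LinearMap.sum_apply, LinearMap.comp_apply, ← map_sum, LinearMap.proj_apply,
      LinearMap.coe_single, Finset.univ_sum_single]
  conv_lhs => rw [hT, map_sum]
  exact Finset.sum_congr rfl fun i _ => LinearMap.trace_comp_comm' _ _

variable {G : Type u} [Group G] (H : Subgroup G)

/-- The cocycle `G × G ⧸ H → H` attached to the section `Quotient.out` of `G → G ⧸ H`. -/
noncomputable def cosetCocycle (g : G) (c : G ⧸ H) : H :=
  ⟨c.out⁻¹ * g * (g⁻¹ • c).out, by
    have h : ((g⁻¹ * c.out : G) : G ⧸ H) = (((g⁻¹ • c).out : G) : G ⧸ H) := by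
      rw [QuotientGroup.out_eq', ← smul_eq_mul, ← MulAction.Quotient.smul_coe,
        QuotientGroup.out_eq']
    simpa using QuotientGroup.eq.1 h⟩

lemma cosetCocycle_one (c : G ⧸ H) : cosetCocycle H 1 c = 1 :=
  Subtype.ext (by simp [cosetCocycle])

lemma cosetCocycle_mul (g h : G) (c : G ⧸ H) :
    cosetCocycle H (g * h) c = cosetCocycle H g c * cosetCocycle H h (g⁻¹ • c) :=
  Subtype.ext (by simp [cosetCocycle, mul_smul, mul_assoc])

lemma isConj_cosetCocycle {g : G} {c : G ⧸ H} (h : g • c = c) :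
    IsConj g (cosetCocycle H g c : G) := by
  have h' : g⁻¹ • c = c := by rw [inv_smul_eq_iff, h]
  exact isConj_iff.2 ⟨c.out⁻¹, by simp [cosetCocycle, h']⟩

/-- The representation of `G` on `G ⧸ H → V` induced from the representation `ρ` of `H`. -/
noncomputable def indRep {K V : Type*} [Field K] [AddCommGroup V] [Module K V]
    (ρ : Representation K H V) : Representation K G (G ⧸ H → V) where
  toFun g := LinearMap.pi fun c => ρ (cosetCocycle H g c) ∘ₗ LinearMap.proj (g⁻¹ • c)
  map_one' := LinearMap.ext fun φ => funext fun c => by simp [cosetCocycle_one]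
  map_mul' g h := LinearMap.ext fun φ => funext fun c => by
    simp [cosetCocycle_mul, mul_smul]

/-- Induction of functions from `H` to `G`. -/
noncomputable def indFun (K : Type*) [Field K] [Fintype (G ⧸ H)] : (H → K) →ₗ[K] (G → K) where
  toFun f g := ∑ c : G ⧸ H, if g • c = c then f (cosetCocycle H g c) else 0
  map_add' f₁ f₂ := funext fun g => by
    simp only [Pi.add_apply, ← Finset.sum_add_distrib]
    exact Finset.sum_congr rfl fun c _ => by split_ifs <;> simp
  map_smul' a f := funext fun g => by
    simp only [Pi.smul_apply, RingHom.id_apply, Finset.smul_sum]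
    exact Finset.sum_congr rfl fun c _ => by split_ifs <;> simp

lemma indFun_apply (K : Type*) [Field K] [Fintype (G ⧸ H)] (f : H → K) (g : G) :
    indFun H K f g = ∑ c : G ⧸ H, if g • c = c then f (cosetCocycle H g c) else 0 := rfl

lemma trace_indRep {K V : Type*} [Field K] [AddCommGroup V] [Module K V] [Module.Finite K V]
    [Fintype (G ⧸ H)] (ρ : Representation K H V) (g : G) :
    LinearMap.trace K _ (indRep H ρ g) = indFun H K (fun h => LinearMap.trace K V (ρ h)) g := by
  rw [LinearMap.trace_pi, indFun_apply]
  refine Finset.sum_congr rfl fun c _ => ?_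
  split_ifs with h
  · have h' : g⁻¹ • c = c := by rw [inv_smul_eq_iff, h]
    congr 1
    refine LinearMap.ext fun v => ?_
    simp [indRep, h']
  · have h' : g⁻¹ • c ≠ c := fun h' => h (by rw [inv_smul_eq_iff] at h'; exact h'.symm)
    convert map_zero (LinearMap.trace K V)
    refine LinearMap.ext fun v => ?_
    simp [indRep, h']

lemma indFun_mem_charSet {K : Type u} [Field K] [Fintype (G ⧸ H)] {χ : H → K}
    (hχ : χ ∈ charSet K H) : indFun H K χ ∈ charSet K G := by
  obtain ⟨V, rfl⟩ := hχ
  exact ⟨FDRep.of (indRep H V.ρ), funext fun g => (trace_indRep H V.ρ g).symm⟩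

lemma indFun_mem_locCharRing {𝒪 : Type*} {K : Type u} [CommRing 𝒪] [Field K] [Algebra 𝒪 K]
    {𝔭 : Ideal 𝒪} [𝔭.IsPrime] [Fintype (G ⧸ H)] {f : H → K} (hf : f ∈ locCharRing 𝒪 K 𝔭 H) :
    indFun H K f ∈ locCharRing 𝒪 K 𝔭 G := by
  have hf' := locCharRing_le_closure hf
  clear hf
  induction hf' using AddSubgroup.closure_induction with
  | mem f hf =>
    obtain ⟨a, ha, χ, hχ, rfl⟩ := hf
    rw [map_smul]
    exact mul_mem (const_mem_locCharRing ha)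
      (Subring.subset_closure (Or.inr (indFun_mem_charSet H hχ)))
  | zero => rw [map_zero]; exact zero_mem _
  | add f g _ _ h₁ h₂ => rw [map_add]; exact add_mem h₁ h₂
  | neg f _ h => rw [map_neg]; exact neg_mem h

lemma indFun_one_apply (K : Type*) [Field K] [Fintype (G ⧸ H)] (g : G) :
    indFun H K 1 g = (Nat.card {c : G ⧸ H // g • c = c} : K) := by
  rw [indFun_apply, Nat.card_eq_fintype_card, Fintype.card_subtype]
  simp

/-- On elements whose `G`-class meets `H` in points where `f` is constant, induction of `f`
is multiplication by the permutation character. -/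
lemma indFun_apply_of_forall_isConj {K : Type*} [Field K] [Fintype (G ⧸ H)] (f : H → K) {g : G}
    {a : K} (h : ∀ x : H, IsConj g x → f x = a) : indFun H K f g = indFun H K 1 g * a := by
  rw [indFun_apply, indFun_apply, Finset.sum_mul]
  refine Finset.sum_congr rfl fun c _ => ?_
  split_ifs with hc
  · simp [h _ (isConj_cosetCocycle H hc)]
  · simp

end Induction

section Block

/-- A function in a subring with natural values `n` divides, on a finite set and inside the subring,
the constant `∏ n`. -/
lemma Subring.exists_mul_eq_prod {G K : Type*} [CommRing K] (R : Subring (G → K)) {π : G → K}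
    (hπ : π ∈ R) (n : G → ℕ) (hn : ∀ g, π g = n g) (S : Finset G) :
    ∃ q ∈ R, ∀ g ∈ S, π g * q g = ((∏ s ∈ S, n s : ℕ) : K) := by
  induction S using Finset.induction_on with
  | empty => exact ⟨0, zero_mem _, by simp⟩
  | insert a S ha ih =>
    obtain ⟨q, hq, h⟩ := ih
    refine ⟨(n a : G → K) * q + (((∏ s ∈ S, n s : ℕ) : G → K) - π * q),
      add_mem (mul_mem (natCast_mem _ _) hq) (sub_mem (natCast_mem _ _) (mul_mem hπ hq)), ?_⟩
    intro g hg
    rw [Finset.prod_insert ha]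
    simp only [Pi.add_apply, Pi.sub_apply, Pi.mul_apply, Pi.natCast_apply, Nat.cast_mul]
    rcases Finset.mem_insert.1 hg with rfl | hg
    · rw [hn]
      ring
    · rw [h g hg, ← h g hg]
      ring

lemma natCast_notMem_of_coprime {𝒪 : Type*} [CommRing 𝒪] {𝔭 : Ideal 𝒪} (h𝔭 : 𝔭 ≠ ⊤) {p n : ℕ}
    (hp : (p : 𝒪) ∈ 𝔭) (hn : Nat.Coprime n p) : (n : 𝒪) ∉ 𝔭 := by
  intro h
  obtain ⟨a, b, hab⟩ := (Nat.isCoprime_iff_coprime.2 hn).map (Int.castRingHom 𝒪)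
  refine h𝔭 ((Ideal.eq_top_iff_one 𝔭).2 ?_)
  rw [← hab]
  simp only [map_natCast]
  exact 𝔭.add_mem (𝔭.mul_mem_left _ h) (𝔭.mul_mem_left _ hp)

variable {𝒪 : Type*} {K : Type u} [CommRing 𝒪] [Field K] [Algebra 𝒪 K] {𝔭 : Ideal 𝒪}

lemma natCast_ne_zero_of_notMem [FaithfulSMul 𝒪 K] {n : ℕ} (hn : (n : 𝒪) ∉ 𝔭) :
    (n : K) ≠ 0 := by
  intro h
  rw [← map_natCast (algebraMap 𝒪 K)] at h
  rw [(FaithfulSMul.algebraMap_injective 𝒪 K) (h.trans (map_zero _).symm)] at hn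
  exact hn 𝔭.zero_mem

lemma inv_natCast_mem_locSet [FaithfulSMul 𝒪 K] {n : ℕ} (hn : (n : 𝒪) ∉ 𝔭) :
    (n : K)⁻¹ ∈ locSet 𝒪 K 𝔭 :=
  ⟨1, n, hn, by simp [natCast_ne_zero_of_notMem (K := K) hn]⟩

variable {p : ℕ} [Fact p.Prime] {G : Type u} [Group G] [Finite G] (H : Subgroup G)

lemma eFun_one_comp_subtype :
    (eFun p K (1 : G)) ∘ ((↑) : H → G) = eFun p K (1 : H) := by
  ext h
  simp only [Function.comp_apply, eFun_one_apply, IsPElement.coe_iff]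

lemma apply_eq_zero_of_mul_eFun_one {f : G → K} (h : f * eFun p K (1 : G) = f) {g : G}
    (hg : ¬ IsPElement p g) : f g = 0 := by
  rw [← h, Pi.mul_apply, eFun_one_apply, if_neg hg, mul_zero]

variable {H}

lemma eq_of_comp_subtype_eq (hind : Nat.Coprime H.index p) {f₁ f₂ : G → K}
    (h₁ : f₁ ∈ locCharRing 𝒪 K 𝔭 G) (he₁ : f₁ * eFun p K (1 : G) = f₁)
    (h₂ : f₂ ∈ locCharRing 𝒪 K 𝔭 G) (he₂ : f₂ * eFun p K (1 : G) = f₂)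
    (h : f₁ ∘ ((↑) : H → G) = f₂ ∘ ((↑) : H → G)) : f₁ = f₂ := by
  ext g
  by_cases hg : IsPElement p g
  · have hcop := hg.coprime_card_fixed hind
    have hne : Nonempty {c : G ⧸ H // g • c = c} := by
      by_contra hempty
      rw [not_nonempty_iff] at hempty
      rw [Nat.card_of_isEmpty, Nat.coprime_zero_left] at hcop
      exact (Fact.out : p.Prime).ne_one hcop
    obtain ⟨c, hc⟩ := hne
    have hconj := isConj_cosetCocycle H hc
    rw [apply_eq_of_isConj_of_mem_locCharRing h₁ hconj,
      apply_eq_of_isConj_of_mem_locCharRing h₂ hconj]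
    exact congrFun h _
  · rw [apply_eq_zero_of_mul_eFun_one he₁ hg, apply_eq_zero_of_mul_eFun_one he₂ hg]

lemma exists_comp_subtype_eq [h𝔭 : 𝔭.IsPrime] [FaithfulSMul 𝒪 K] (hp : (p : 𝒪) ∈ 𝔭)
    (hind : Nat.Coprime H.index p)
    (hfusion : ∀ x y : H, IsPElement p (x : G) → IsPElement p (y : G) →
      IsConj (x : G) (y : G) → IsConj x y)
    (he : eFun p K (1 : G) ∈ locCharRing 𝒪 K 𝔭 G) {f' : H → K}
    (hf' : f' ∈ locCharRing 𝒪 K 𝔭 H) (hef' : f' * eFun p K (1 : H) = f') :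
    ∃ f : G → K, f ∈ locCharRing 𝒪 K 𝔭 G ∧ f * eFun p K (1 : G) = f ∧
      f ∘ ((↑) : H → G) = f' := by
  have : Fintype (G ⧸ H) := Fintype.ofFinite _
  have : Fintype G := Fintype.ofFinite _
  set S : Finset G := Finset.univ.filter (IsPElement p) with hS
  obtain ⟨q, hq, hπq⟩ := (locCharRing 𝒪 K 𝔭 G).exists_mul_eq_prod
    (indFun_mem_locCharRing H (one_mem _)) _ (indFun_one_apply H K) S
  set N := ∏ s ∈ S, Nat.card {c : G ⧸ H // s • c = c} with hN
  have hNp : Nat.Coprime N p := Nat.Coprime.prod_left fun s hs =>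
    IsPElement.coprime_card_fixed hind (Finset.mem_filter.1 hs).2
  have hN𝔭 : (N : 𝒪) ∉ 𝔭 := natCast_notMem_of_coprime h𝔭.ne_top hp hNp
  refine ⟨indFun H K f' * q * Function.const G (N : K)⁻¹ * eFun p K (1 : G),
    mul_mem (mul_mem (mul_mem (indFun_mem_locCharRing H hf') hq)
      (const_mem_locCharRing (inv_natCast_mem_locSet hN𝔭))) he, ?_, ?_⟩
  · ext g
    simp only [Pi.mul_apply, eFun_one_apply]
    split_ifs <;> simp
  · ext h
    simp only [Function.comp_apply, Pi.mul_apply, eFun_one_apply, Function.const_apply]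
    split_ifs with hh
    · have hind_apply : indFun H K f' h = indFun H K 1 h * f' h :=
        indFun_apply_of_forall_isConj H f' fun x hx =>
          apply_eq_of_isConj_of_mem_locCharRing hf'
            (hfusion x h (hh.of_isConj hx) hh hx.symm)
      have hπ := hπq (h : G) (by simpa [hS] using hh)
      have hN0 : (N : K) ≠ 0 := natCast_ne_zero_of_notMem hN𝔭
      rw [hind_apply, mul_one, mul_right_comm (indFun H K 1 (h : G)), hπ]
      field_simp
    · rw [mul_zero, apply_eq_zero_of_mul_eFun_one hef' (mt (IsPElement.coe_iff h).2 hh)]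

end Block

section Quotient

/-- Restriction to a subgroup as a ring morphism `𝒪_𝔭R(G) →+* 𝒪_𝔭R(H)`. -/
def locCharRingRes (𝒪 : Type*) (K : Type u) [CommRing 𝒪] [Field K] [Algebra 𝒪 K] (𝔭 : Ideal 𝒪)
    {G : Type u} [Group G] (H : Subgroup G) : locCharRing 𝒪 K 𝔭 G →+* locCharRing 𝒪 K 𝔭 H where
  toFun f := ⟨(f : G → K) ∘ ((↑) : H → G), comp_subtype_mem_locCharRing H f.2⟩
  map_one' := rfl
  map_mul' _ _ := rfl
  map_zero' := rfl
  map_add' _ _ := rfl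

variable {𝒪 : Type*} {K : Type u} [CommRing 𝒪] [Field K] [Algebra 𝒪 K] {𝔭 : Ideal 𝒪}
  {G : Type u} [Group G] {H : Subgroup G}

lemma pConstIdeal_eq_map [𝔭.IsMaximal] :
    pConstIdeal 𝒪 K 𝔭 G = 𝔭.map (constRingHom 𝒪 K 𝔭 G) := by
  unfold pConstIdeal Ideal.map
  congr 1
  ext f
  constructor
  · rintro ⟨a, ha, hf⟩
    exact ⟨a, ha, Subtype.ext hf.symm⟩
  · rintro ⟨a, ha, rfl⟩
    exact ⟨a, ha, rfl⟩

variable [𝔭.IsMaximal] {eG : locCharRing 𝒪 K 𝔭 G} {eH : locCharRing 𝒪 K 𝔭 H}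

lemma locCharRingRes_comp_constRingHom :
    (locCharRingRes 𝒪 K 𝔭 H).comp (constRingHom 𝒪 K 𝔭 G) = constRingHom 𝒪 K 𝔭 H := rfl

lemma blockIdeal_le_comap (hres : locCharRingRes 𝒪 K 𝔭 H eG = eH) :
    blockIdeal 𝒪 K 𝔭 G eG ≤ (blockIdeal 𝒪 K 𝔭 H eH).comap (locCharRingRes 𝒪 K 𝔭 H) := by
  refine sup_le ?_ ?_
  · rw [← Ideal.map_le_iff_le_comap, pConstIdeal_eq_map, Ideal.map_map,
      locCharRingRes_comp_constRingHom, ← pConstIdeal_eq_map]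
    exact le_sup_left
  · rw [Ideal.span_singleton_le_iff_mem, Ideal.mem_comap, map_sub, map_one, hres]
    exact Ideal.mem_sup_right (Ideal.mem_span_singleton_self _)

lemma exists_mem_pConstIdeal_res_eq (hres : locCharRingRes 𝒪 K 𝔭 H eG = eH)
    (hG : eG * eG = eG) (hH : eH * eH = eH)
    (hsurj : ∀ y, ∃ x, x * eG = x ∧ locCharRingRes 𝒪 K 𝔭 H x = y * eH)
    {a : locCharRing 𝒪 K 𝔭 H} (ha : a ∈ pConstIdeal 𝒪 K 𝔭 H) :
    ∃ b ∈ pConstIdeal 𝒪 K 𝔭 G, b * eG = b ∧ locCharRingRes 𝒪 K 𝔭 H b = a * eH := by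
  rw [pConstIdeal_eq_map] at ha ⊢
  induction ha using Submodule.span_induction with
  | mem a ha =>
    obtain ⟨r, hr, rfl⟩ := ha
    refine ⟨constRingHom 𝒪 K 𝔭 G r * eG, Ideal.mul_mem_right _ _ (Ideal.mem_map_of_mem _ hr),
      by rw [mul_assoc, hG], ?_⟩
    rw [map_mul, hres, ← locCharRingRes_comp_constRingHom, RingHom.comp_apply]
  | zero => exact ⟨0, zero_mem _, by simp, by simp⟩
  | add a b _ _ h₁ h₂ =>
    obtain ⟨a', ha', hae, har⟩ := h₁
    obtain ⟨b', hb', hbe, hbr⟩ := h₂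
    exact ⟨a' + b', add_mem ha' hb', by rw [add_mul, hae, hbe], by rw [map_add, har, hbr, add_mul]⟩
  | smul y a _ h =>
    obtain ⟨a', ha', hae, har⟩ := h
    obtain ⟨x, -, hxr⟩ := hsurj y
    refine ⟨x * a', Ideal.mul_mem_left _ _ ha', by rw [mul_assoc, hae], ?_⟩
    rw [map_mul, har, hxr, mul_mul_mul_comm, hH, smul_eq_mul]

lemma comap_blockIdeal (hres : locCharRingRes 𝒪 K 𝔭 H eG = eH)
    (hG : eG * eG = eG) (hH : eH * eH = eH)
    (hinj : ∀ x y, x * eG = x → y * eG = y →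
      locCharRingRes 𝒪 K 𝔭 H x = locCharRingRes 𝒪 K 𝔭 H y → x = y)
    (hsurj : ∀ y, ∃ x, x * eG = x ∧ locCharRingRes 𝒪 K 𝔭 H x = y * eH) :
    (blockIdeal 𝒪 K 𝔭 H eH).comap (locCharRingRes 𝒪 K 𝔭 H) = blockIdeal 𝒪 K 𝔭 G eG := by
  refine le_antisymm (fun f hf => ?_) (blockIdeal_le_comap hres)
  obtain ⟨a, ha, b, hb, hab⟩ := Submodule.mem_sup.1 (Ideal.mem_comap.1 hf)
  obtain ⟨c, rfl⟩ := Ideal.mem_span_singleton'.1 hb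
  obtain ⟨a', ha', hae, har⟩ := exists_mem_pConstIdeal_res_eq hres hG hH hsurj ha
  have hfe : f * eG = a' := by
    refine hinj _ _ (by rw [mul_assoc, hG]) hae ?_
    rw [har, map_mul, hres, ← hab]
    linear_combination (-c) * hH
  have hf_eq : f = a' + f * (1 - eG) := by
    rw [← hfe]
    ring
  rw [hf_eq]
  exact add_mem (Ideal.mem_sup_left ha')
    (Ideal.mem_sup_right (Ideal.mul_mem_left _ _ (Ideal.mem_span_singleton_self _)))

/-- If restriction induces a bijection between `𝒪_𝔭R(G)·e_G` and `𝒪_𝔭R(H)·e_H`, then it induces an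
isomorphism of the reductions of these blocks modulo `𝔭`, compatible with scalars. -/
lemma exists_blockAlg_equiv (hres : locCharRingRes 𝒪 K 𝔭 H eG = eH)
    (hG : eG * eG = eG) (hH : eH * eH = eH)
    (hinj : ∀ x y, x * eG = x → y * eG = y →
      locCharRingRes 𝒪 K 𝔭 H x = locCharRingRes 𝒪 K 𝔭 H y → x = y)
    (hsurj : ∀ y, ∃ x, x * eG = x ∧ locCharRingRes 𝒪 K 𝔭 H x = y * eH) :
    ∃ e : blockAlg 𝒪 K 𝔭 G eG ≃+* blockAlg 𝒪 K 𝔭 H eH,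
      ∀ x, e (blockScalars 𝒪 K 𝔭 G eG x) = blockScalars 𝒪 K 𝔭 H eH x := by
  have hcomap := comap_blockIdeal hres hG hH hinj hsurj
  let F : blockAlg 𝒪 K 𝔭 G eG →+* blockAlg 𝒪 K 𝔭 H eH :=
    Ideal.quotientMap _ (locCharRingRes 𝒪 K 𝔭 H) hcomap.ge
  have hF : Function.Bijective F := by
    refine ⟨Ideal.quotientMap_injective' hcomap.le, fun y => ?_⟩
    obtain ⟨y, rfl⟩ := Ideal.Quotient.mk_surjective y
    obtain ⟨x, -, hx⟩ := hsurj y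
    refine ⟨Ideal.Quotient.mk _ x, ?_⟩
    rw [Ideal.quotientMap_mk, hx, Ideal.Quotient.eq]
    refine Ideal.mem_sup_right (Ideal.mem_span_singleton'.2 ⟨-y, ?_⟩)
    ring
  refine ⟨RingEquiv.ofBijective F hF, fun x => ?_⟩
  obtain ⟨x, rfl⟩ := Ideal.Quotient.mk_surjective x
  rfl

end Quotient

end AuxiliaryLemmas

variable {𝒪 : Type*} [CommRing 𝒪] [IsDomain 𝒪] [IsDedekindDomain 𝒪] [CharZero 𝒪]
variable {K : Type u} [Field K] [Algebra 𝒪 K] [IsFractionRing 𝒪 K]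
variable {𝔭 : Ideal 𝒪} [𝔭.IsMaximal]

set_option maxHeartbeats 2000000 in
set_option synthInstance.maxHeartbeats 1000000 in
/-- If `H ≤ G` has index prime to `p` and controls the fusion of
`p`-elements (any two `p`-elements of `H` conjugate in `G` are conjugate in `H`), then
restriction induces an isomorphism of `𝒪_𝔭`-algebras `R_𝔭(G,1) ≅ R_𝔭(H,1)`; in particular
`ℓ_p(G,1) = ℓ_p(H,1)` and `ext_p^1(G,1) = ext_p^1(H,1)`. -/
theorem principal_block_iso_of_fusion_control
    (p : ℕ) [Fact p.Prime] (hp : (p : 𝒪) ∈ 𝔭)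
    {G : Type u} [Group G] [Finite G]
    (ζ : K) (hζ : IsPrimitiveRoot ζ (Nat.card G))
    (H : Subgroup G) (hind : Nat.Coprime H.index p)
    (hfusion : ∀ x y : H, IsPElement p (x : G) → IsPElement p (y : G) →
      IsConj (x : G) (y : G) → IsConj x y)
    (he1G : eFun p K (1 : G) ∈ locCharRing 𝒪 K 𝔭 G)
    (he1H : eFun p K (1 : H) ∈ locCharRing 𝒪 K 𝔭 H) :
    ((eFun p K (1 : G)) ∘ ((↑) : H → G) = eFun p K (1 : H)) ∧
    (∀ f : G → K, f ∈ locCharRing 𝒪 K 𝔭 G → f * eFun p K (1 : G) = f →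
        (f ∘ ((↑) : H → G)) ∈ locCharRing 𝒪 K 𝔭 H ∧
        (f ∘ ((↑) : H → G)) * eFun p K (1 : H) = f ∘ ((↑) : H → G)) ∧
    (∀ f₁ f₂ : G → K,
        f₁ ∈ locCharRing 𝒪 K 𝔭 G → f₁ * eFun p K (1 : G) = f₁ →
        f₂ ∈ locCharRing 𝒪 K 𝔭 G → f₂ * eFun p K (1 : G) = f₂ →
        f₁ ∘ ((↑) : H → G) = f₂ ∘ ((↑) : H → G) → f₁ = f₂) ∧
    (∀ f' : H → K, f' ∈ locCharRing 𝒪 K 𝔭 H → f' * eFun p K (1 : H) = f' →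
        ∃ f : G → K, f ∈ locCharRing 𝒪 K 𝔭 G ∧ f * eFun p K (1 : G) = f ∧
          f ∘ ((↑) : H → G) = f') ∧
    loewyLength (blockAlg 𝒪 K 𝔭 G ⟨eFun p K (1 : G), he1G⟩) =
      loewyLength (blockAlg 𝒪 K 𝔭 H ⟨eFun p K (1 : H), he1H⟩) ∧
    extDim (𝒪 ⧸ 𝔭) (blockScalars 𝒪 K 𝔭 G ⟨eFun p K (1 : G), he1G⟩) =
      extDim (𝒪 ⧸ 𝔭) (blockScalars 𝒪 K 𝔭 H ⟨eFun p K (1 : H), he1H⟩) := by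
  have : FaithfulSMul 𝒪 K := (faithfulSMul_iff_algebraMap_injective 𝒪 K).2
    (IsFractionRing.injective 𝒪 K)
  have hidem {Γ : Type u} [Group Γ] [Finite Γ] :
      eFun p K (1 : Γ) * eFun p K (1 : Γ) = eFun p K (1 : Γ) := by
    ext g
    simp [eFun_one_apply]
  have hres := eFun_one_comp_subtype (K := K) (p := p) H
  have hsurj := fun (f' : H → K) hf' hef' =>
    exists_comp_subtype_eq (f' := f') hp hind hfusion he1G hf' hef'
  obtain ⟨e, he⟩ := exists_blockAlg_equiv (eG := ⟨_, he1G⟩) (eH := ⟨_, he1H⟩)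
    (Subtype.ext hres) (Subtype.ext hidem) (Subtype.ext hidem)
    (fun x y hx hy hxy => Subtype.ext (eq_of_comp_subtype_eq hind x.2 (congrArg Subtype.val hx)
      y.2 (congrArg Subtype.val hy) (congrArg Subtype.val hxy)))
    (fun y => by
      obtain ⟨f, hf, hfe, hfr⟩ := hsurj (y * eFun p K (1 : H)) (mul_mem y.2 he1H)
        (by rw [mul_assoc, hidem])
      exact ⟨⟨f, hf⟩, Subtype.ext hfe, Subtype.ext hfr⟩)
  refine ⟨hres, fun f hf hfe => ⟨comp_subtype_mem_locCharRing H hf, ?_⟩,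
    fun f₁ f₂ h₁ he₁ h₂ he₂ h => eq_of_comp_subtype_eq hind h₁ he₁ h₂ he₂ h, hsurj,
    loewyLength_congr e, extDim_congr e _ _ he⟩
  rw [← hres]
  exact congrArg (· ∘ ((↑) : H → G)) hfe
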